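/- arXiv:2512.00709 — 5 statements merged into one kernel-verified Lean document; each statement's English description precedes it below -/
import Mathlib

section
/- Let n ≥ 1, let g : ℝⁿ → ℝ be differentiable at a point θ ∈ ℝⁿ, let β ∈ ℝ and ε ∈ [0,1). Define L(θ) = −log((1 − ε)·σ(β g(θ)) + ε·(1 − σ(β g(θ)))). Then L is differentiable at θ and its gradient equals ∇L(θ) = −[(1 − 2ε)p / ((1 − 2ε)p + ε)] · (1 − p) · β · ∇g(θ), where p = σ(β g(θ)). (In particular the FA-DPO gradient weight is ζ_FA-DPO = [(1 − 2ε)p / ((1 − 2ε)p + ε)] · (1 − p), a reparametrization of the DPO weight ζ_DPO = 1 − p.) -/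
open Real

/-- The logistic sigmoid `σ(z) = 1/(1 + exp(−z))`. -/
noncomputable def logisticSigmoid (z : ℝ) : ℝ := 1 / (1 + Real.exp (-z))

/-- Gradient of the FA-DPO per-sample loss
`L(θ) = −log((1 − ε)·σ(β g(θ)) + ε·(1 − σ(β g(θ))))`:
`L` is differentiable at `θ` and
`∇L(θ) = −[(1 − 2ε)p / ((1 − 2ε)p + ε)]·(1 − p)·β·∇g(θ)` with `p = σ(β g(θ))`. -/
theorem fadpo_gradient (n : ℕ) (hn : 1 ≤ n)
    (g : EuclideanSpace ℝ (Fin n) → ℝ) (θ : EuclideanSpace ℝ (Fin n))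
    (hg : DifferentiableAt ℝ g θ) (β ε : ℝ) (hε0 : 0 ≤ ε) (hε1 : ε < 1)
    (L : EuclideanSpace ℝ (Fin n) → ℝ)
    (hL : L = fun θ' =>
      -Real.log ((1 - ε) * logisticSigmoid (β * g θ')
        + ε * (1 - logisticSigmoid (β * g θ')))) :
    DifferentiableAt ℝ L θ ∧
      gradient L θ =
        (-(((1 - 2 * ε) * logisticSigmoid (β * g θ)
              / ((1 - 2 * ε) * logisticSigmoid (β * g θ) + ε))
            * (1 - logisticSigmoid (β * g θ)) * β)) • gradient g θ := by
  have hs : logisticSigmoid = Real.sigmoid := by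
    funext z
    simp [logisticSigmoid, Real.sigmoid_def]
  subst hL
  rw [hs]
  have hp0 := Real.sigmoid_pos (β * g θ)
  have hp1 := Real.sigmoid_lt_one (β * g θ)
  have hpos : 0 < (1 - ε) * Real.sigmoid (β * g θ) + ε * (1 - Real.sigmoid (β * g θ)) := by
    have h1 : 0 < (1 - ε) * Real.sigmoid (β * g θ) := mul_pos (by linarith) hp0
    have h2 : 0 ≤ ε * (1 - Real.sigmoid (β * g θ)) := mul_nonneg hε0 (by linarith)
    linarith
  have hσ : HasDerivAt (fun t : ℝ => Real.sigmoid (β * t))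
      (Real.sigmoid (β * g θ) * (1 - Real.sigmoid (β * g θ)) * (β * 1)) (g θ) :=
    (Real.hasDerivAt_sigmoid (β * g θ)).comp (g θ) ((hasDerivAt_id (g θ)).const_mul β)
  have hd := (((hσ.const_mul (1 - ε)).add ((hσ.const_sub 1).const_mul ε)).log hpos.ne').neg
  have hF := hd.comp_hasFDerivAt θ hg.hasFDerivAt
  refine ⟨hF.differentiableAt, ?_⟩
  have hE : (1 - 2 * ε) * Real.sigmoid (β * g θ) + ε
      = (1 - ε) * Real.sigmoid (β * g θ) + ε * (1 - Real.sigmoid (β * g θ)) := by ring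
  have hf := hF.fderiv
  unfold gradient
  refine (congrArg _ hf).trans ?_
  rw [hE, map_smulₛₗ]
  congr 1
  simp only [Pi.add_apply, conj_trivial]
  ring
end

section
/- Let (X, μ) be a probability space, let p* : X → ℝ be measurable with values in (0,1), and let ε : X → ℝ be measurable with values in [0, 1/2). For measurable q : X → ℝ with values in (0,1), define the corrected population risk L(q) = ∫ CE(T_{ε(x)}(p*(x)), T_{ε(x)}(q(x))) dμ(x), where the integrand is nonnegative and the integral is taken as a (possibly infinite) lower Lebesgue integral. Then L(q) ≥ L(p*) for every such q, and if L(p*) < ∞ then L(q) = L(p*) holds if and only if q = p* μ-almost everywhere. -/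
open MeasureTheory
open scoped ENNReal

/-- Corrupted preference probability `T_ε(p) = (1 − ε)p + ε(1 − p)`. -/
def flipProb (ε p : ℝ) : ℝ := (1 - ε) * p + ε * (1 - p)

/-- Binary cross-entropy `CE(a, q) = −(a log q + (1 − a) log(1 − q))`. -/
noncomputable def binCE (a q : ℝ) : ℝ := -(a * Real.log q + (1 - a) * Real.log (1 - q))

theorem aux_log (a b : ℝ) (ha : 0 < a) (hb : 0 < b) :
    a * (Real.log b - Real.log a) ≤ b - a := by
  have h := Real.log_le_sub_one_of_pos (div_pos hb ha)
  rw [Real.log_div hb.ne' ha.ne'] at h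
  have h2 := mul_le_mul_of_nonneg_left h ha.le
  have h3 : a * (b / a - 1) = b - a := by field_simp
  linarith

theorem aux_log_lt (a b : ℝ) (ha : 0 < a) (hb : 0 < b) (hab : b ≠ a) :
    a * (Real.log b - Real.log a) < b - a := by
  have h := Real.log_lt_sub_one_of_pos (div_pos hb ha)
    (fun h => hab ((div_eq_one_iff_eq ha.ne').1 h))
  rw [Real.log_div hb.ne' ha.ne'] at h
  have h2 := mul_lt_mul_of_pos_left h ha
  have h3 : a * (b / a - 1) = b - a := by field_simp
  linarith

theorem binCE_lt (a b : ℝ) (ha : a ∈ Set.Ioo (0:ℝ) 1) (hb : b ∈ Set.Ioo (0:ℝ) 1)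
    (hab : b ≠ a) : binCE a a < binCE a b := by
  have h1 := aux_log_lt a b ha.1 hb.1 hab
  have h2 := aux_log (1 - a) (1 - b) (by linarith [ha.2]) (by linarith [hb.2])
  unfold binCE
  nlinarith

theorem binCE_pos (a b : ℝ) (ha : a ∈ Set.Ioo (0:ℝ) 1) (hb : b ∈ Set.Ioo (0:ℝ) 1) :
    0 < binCE a b := by
  have h1 := mul_neg_of_pos_of_neg ha.1 (Real.log_neg hb.1 hb.2)
  have h2 := mul_neg_of_pos_of_neg (sub_pos.2 ha.2)
    (Real.log_neg (sub_pos.2 hb.2) (by linarith [hb.1]))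
  unfold binCE
  linarith

theorem flipProb_mem (e p : ℝ) (he : e ∈ Set.Ico (0:ℝ) (1/2)) (hp : p ∈ Set.Ioo (0:ℝ) 1) :
    flipProb e p ∈ Set.Ioo (0:ℝ) 1 := by
  obtain ⟨h1, h2⟩ := he
  obtain ⟨h3, h4⟩ := hp
  unfold flipProb
  constructor
  · have := mul_pos (show 0 < 1 - e by linarith) h3
    have := mul_nonneg h1 (sub_pos.2 h4).le
    linarith
  · have := mul_pos (show 0 < 1 - e by linarith) (sub_pos.2 h4)
    have := mul_nonneg h1 h3.le
    nlinarith

theorem flipProb_inj (e p r : ℝ) (he : e ∈ Set.Ico (0:ℝ) (1/2))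
    (h : flipProb e p = flipProb e r) : p = r := by
  unfold flipProb at h
  have h1 : (1 - 2 * e) * (p - r) = 0 := by linarith
  rcases mul_eq_zero.1 h1 with h | h
  · linarith [he.2]
  · linarith

/-- population consistency of the flipping-corrected cross-entropy risk.
With `L(q) = ∫⁻ CE(T_{ε(x)}(p*(x)), T_{ε(x)}(q(x))) dμ` (lower Lebesgue integral of the
nonnegative integrand), one has `L(q) ≥ L(p*)`, and if `L(p*) < ∞` then
`L(q) = L(p*) ↔ q = p*` μ-a.e. -/
theorem flipping_corrected_population_consistency
    {X : Type*} [MeasurableSpace X] (μ : Measure X) [IsProbabilityMeasure μ]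
    (pstar ε q : X → ℝ)
    (hpstar_meas : Measurable pstar) (hpstar : ∀ x, pstar x ∈ Set.Ioo (0 : ℝ) 1)
    (hε_meas : Measurable ε) (hε : ∀ x, ε x ∈ Set.Ico (0 : ℝ) (1 / 2))
    (hq_meas : Measurable q) (hq : ∀ x, q x ∈ Set.Ioo (0 : ℝ) 1)
    (L : (X → ℝ) → ℝ≥0∞)
    (hL : L = fun f => ∫⁻ x, ENNReal.ofReal
      (binCE (flipProb (ε x) (pstar x)) (flipProb (ε x) (f x))) ∂μ) :
    L q ≥ L pstar ∧ (L pstar < ⊤ → (L q = L pstar ↔ q =ᵐ[μ] pstar)) := by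
  subst hL
  have hlt : ∀ x, q x ≠ pstar x →
      ENNReal.ofReal (binCE (flipProb (ε x) (pstar x)) (flipProb (ε x) (pstar x))) <
      ENNReal.ofReal (binCE (flipProb (ε x) (pstar x)) (flipProb (ε x) (q x))) := by
    intro x hx
    have ha := flipProb_mem _ _ (hε x) (hpstar x)
    have hb := flipProb_mem _ _ (hε x) (hq x)
    exact (ENNReal.ofReal_lt_ofReal_iff (binCE_pos _ _ ha hb)).2
      (binCE_lt _ _ ha hb fun h => hx (flipProb_inj _ _ _ (hε x) h))
  have hle : ∀ x, 
      ENNReal.ofReal (binCE (flipProb (ε x) (pstar x)) (flipProb (ε x) (pstar x))) ≤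
      ENNReal.ofReal (binCE (flipProb (ε x) (pstar x)) (flipProb (ε x) (q x))) := by
    intro x
    by_cases hx : q x = pstar x
    · rw [hx]
    · exact (hlt x hx).le
  refine ⟨lintegral_mono hle, fun hfin => ⟨fun heq => ?_, fun heq => ?_⟩⟩
  · have hm : Measurable fun x => ENNReal.ofReal
        (binCE (flipProb (ε x) (pstar x)) (flipProb (ε x) (q x))) := by
      unfold binCE flipProb
      fun_prop
    have h := ae_eq_of_ae_le_of_lintegral_le (Filter.Eventually.of_forall hle) hfin.ne
      hm.aemeasurable heq.le
    filter_upwards [h] with x hx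
    by_contra hne
    exact (hlt x hne).ne hx
  · refine lintegral_congr_ae ?_
    filter_upwards [heq] with x hx
    simp only [hx]
end

section
/- Let d ≥ 1, z ∈ ℝᵈ, ω* ∈ ℝᵈ, and p ∈ (0,1). Define ε(ω) = σ(⟨ω, z⟩), p̃(ω) = (1 − ε(ω))·p + ε(ω)·(1 − p), and F(ω) = −(p̃(ω*)·log p̃(ω) + (1 − p̃(ω*))·log(1 − p̃(ω))) for ω ∈ ℝᵈ. Then F is differentiable at ω* and ∇F(ω*) = 0. -/
open RealInnerProductSpace

/-- with the logistic flipping model `ε(ω) = σ(⟨ω, z⟩)`,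
corrupted probability `p̃(ω) = (1 − ε(ω))p + ε(ω)(1 − p)`, and population loss
`F(ω) = −(p̃(ω*) log p̃(ω) + (1 − p̃(ω*)) log(1 − p̃(ω)))`,
`F` is differentiable at `ω*` with `∇F(ω*) = 0`. -/
theorem fadpo_flipmodel_stationarity (d : ℕ) (hd : 1 ≤ d)
    (z ωstar : EuclideanSpace ℝ (Fin d)) (p : ℝ) (hp : p ∈ Set.Ioo (0 : ℝ) 1)
    (ptilde : EuclideanSpace ℝ (Fin d) → ℝ)
    (hptilde : ptilde = fun ω =>
      (1 - logisticSigmoid ⟪ω, z⟫) * p + logisticSigmoid ⟪ω, z⟫ * (1 - p))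
    (F : EuclideanSpace ℝ (Fin d) → ℝ)
    (hF : F = fun ω =>
      -(ptilde ωstar * Real.log (ptilde ω) + (1 - ptilde ωstar) * Real.log (1 - ptilde ω))) :
    HasGradientAt F (0 : EuclideanSpace ℝ (Fin d)) ωstar := by
  have hs : logisticSigmoid = Real.sigmoid := by
    funext x
    simp [logisticSigmoid, Real.sigmoid_def]
  rw [hs] at hptilde
  have h0 := Real.sigmoid_pos ⟪ωstar, z⟫
  have h1 := Real.sigmoid_lt_one ⟪ωstar, z⟫
  obtain ⟨hp0, hp1⟩ := hp
  have hq0 : 0 < ptilde ωstar := by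
    rw [hptilde]
    have := mul_pos (sub_pos.2 h1) hp0
    have := mul_pos h0 (sub_pos.2 hp1)
    simp only
    linarith
  have hq1 : 0 < 1 - ptilde ωstar := by
    rw [hptilde]
    have := mul_pos (sub_pos.2 h1) (sub_pos.2 hp1)
    have := mul_pos h0 hp0
    simp only
    nlinarith
  have hd : DifferentiableAt ℝ ptilde ωstar := by
    have hi : DifferentiableAt ℝ (fun ω : EuclideanSpace ℝ (Fin d) => ⟪ω, z⟫) ωstar :=
      differentiableAt_id.inner ℝ (differentiableAt_const z)
    have hc : DifferentiableAt ℝ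
        (fun ω : EuclideanSpace ℝ (Fin d) => Real.sigmoid ⟪ω, z⟫) ωstar :=
      DifferentiableAt.sigmoid hi
    rw [hptilde]
    exact ((hc.const_sub 1).mul_const p).add (hc.mul_const (1 - p))
  have hf := hd.hasFDerivAt
  have hg := (((hf.log hq0.ne').const_mul (ptilde ωstar)).add
    (((hf.const_sub 1).log hq1.ne').const_mul (1 - ptilde ωstar))).neg
  rw [hasGradientAt_iff_hasFDerivAt, hF]
  refine hg.congr_fderiv ?_
  rw [smul_smul, smul_smul, mul_inv_cancel₀ hq0.ne', mul_inv_cancel₀ hq1.ne']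
  simp
end

section
/- Let d ≥ 1, z ∈ ℝᵈ, ω* ∈ ℝᵈ, and p ∈ (0,1). Define ε(ω) = σ(⟨ω, z⟩), p̃(ω) = (1 − ε(ω))·p + ε(ω)·(1 − p), and F(ω) = −(p̃(ω*)·log p̃(ω) + (1 − p̃(ω*))·log(1 − p̃(ω))). Then for every direction v ∈ ℝᵈ, the function t ↦ F(ω* + t·v) is twice differentiable at t = 0 with second derivative equal to (1 − 2p)² · (1/p̃(ω*) + 1/(1 − p̃(ω*))) · σ′(⟨ω*, z⟩)² · ⟨z, v⟩², where σ′(u) = σ(u)(1 − σ(u)). -/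
open RealInnerProductSpace

lemma ls_pos (x : ℝ) : 0 < logisticSigmoid x := by
  unfold logisticSigmoid; positivity

lemma ls_lt_one (x : ℝ) : logisticSigmoid x < 1 := by
  unfold logisticSigmoid
  rw [div_lt_one (by positivity)]
  linarith [Real.exp_pos (-x)]

lemma ls_hasDerivAt (x : ℝ) :
    HasDerivAt logisticSigmoid (logisticSigmoid x * (1 - logisticSigmoid x)) x := by
  have h1 : HasDerivAt (fun y : ℝ => 1 + Real.exp (-y)) (Real.exp (-x) * (-1)) x :=
    ((hasDerivAt_id x).neg.exp).const_add 1
  have hne : 1 + Real.exp (-x) ≠ 0 := by positivity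
  have h2 := (hasDerivAt_const x (1 : ℝ)).div h1 hne
  have h3 : HasDerivAt logisticSigmoid _ x := h2
  convert h3 using 1
  unfold logisticSigmoid
  field_simp
  ring

lemma fadpo_aux (a b p c : ℝ) (hp : p ∈ Set.Ioo (0 : ℝ) 1) (q : ℝ → ℝ)
    (hq : q = fun t => (1 - logisticSigmoid (a + t * b)) * p
      + logisticSigmoid (a + t * b) * (1 - p)) (hc : c = q 0) (G : ℝ → ℝ)
    (hG : G = fun t => -(c * Real.log (q t) + (1 - c) * Real.log (1 - q t))) :
    DifferentiableAt ℝ G 0 ∧ DifferentiableAt ℝ (deriv G) 0 ∧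
      deriv (deriv G) 0 = (1 - 2 * p) ^ 2 * (1 / c + 1 / (1 - c))
        * (logisticSigmoid a * (1 - logisticSigmoid a)) ^ 2 * b ^ 2 := by
  obtain ⟨hp0, hp1⟩ := hp
  have hq0 : ∀ t, 0 < q t := by
    intro t
    have h1 := ls_pos (a + t * b)
    have h2 := ls_lt_one (a + t * b)
    rw [hq]
    have := mul_pos (sub_pos.2 h2) hp0
    have := mul_pos h1 (sub_pos.2 hp1)
    simp only; linarith
  have hq1 : ∀ t, 0 < 1 - q t := by
    intro t
    have h1 := ls_pos (a + t * b)
    have h2 := ls_lt_one (a + t * b)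
    rw [hq]
    have := mul_pos (sub_pos.2 h2) (sub_pos.2 hp1)
    have := mul_pos h1 hp0
    simp only; nlinarith
  have hs : ∀ t, HasDerivAt (fun t => logisticSigmoid (a + t * b))
      (logisticSigmoid (a + t * b) * (1 - logisticSigmoid (a + t * b)) * b) t := by
    intro t
    have h1 : HasDerivAt (fun t : ℝ => a + t * b) (1 * b) t :=
      ((hasDerivAt_id t).mul_const b).const_add a
    rw [one_mul] at h1
    have h2 := HasDerivAt.comp (h₂ := logisticSigmoid) t (ls_hasDerivAt (a + t * b)) h1
    exact h2
  obtain ⟨q', hq'⟩ : ∃ q' : ℝ → ℝ, q' = fun t => (1 - 2 * p) *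
    (logisticSigmoid (a + t * b) * (1 - logisticSigmoid (a + t * b)) * b) := ⟨_, rfl⟩
  have hqd : ∀ t, HasDerivAt q (q' t) t := by
    intro t
    have := (((hs t).const_sub 1).mul_const p).add ((hs t).mul_const (1 - p))
    rw [hq]
    refine this.congr_deriv ?_
    rw [hq']; ring
  have hGd : ∀ t, HasDerivAt G ((-(c / q t) + (1 - c) / (1 - q t)) * q' t) t := by
    intro t
    have h := ((((hqd t).log (hq0 t).ne').const_mul c).add
      ((((hqd t).const_sub 1).log (hq1 t).ne').const_mul (1 - c))).neg
    rw [hG]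
    refine h.congr_deriv ?_
    ring
  have hdG : deriv G = fun t => (-(c / q t) + (1 - c) / (1 - q t)) * q' t :=
    funext fun t => (hGd t).deriv
  have hq'd : DifferentiableAt ℝ q' 0 := by
    have h := (((hs 0).mul ((hs 0).const_sub 1)).mul_const b).const_mul (1 - 2 * p)
    rw [hq']; exact h.differentiableAt
  have hh := (((hasDerivAt_const (0 : ℝ) c).div (hqd 0) (hq0 0).ne').neg.add
    ((hasDerivAt_const (0 : ℝ) (1 - c)).div ((hqd 0).const_sub 1) (hq1 0).ne')).mul
      hq'd.hasDerivAt
  have key : HasDerivAt (deriv G) ((1 - 2 * p) ^ 2 * (1 / c + 1 / (1 - c))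
        * (logisticSigmoid a * (1 - logisticSigmoid a)) ^ 2 * b ^ 2) 0 := by
    rw [hdG]
    refine HasDerivAt.congr_deriv hh ?_
    have e : q' 0 = (1 - 2 * p) * (logisticSigmoid a * (1 - logisticSigmoid a) * b) := by
      rw [hq']; simp
    have c0 : c ≠ 0 := hc ▸ (hq0 0).ne'
    have c1 : 1 - c ≠ 0 := hc ▸ (hq1 0).ne'
    simp only [Pi.add_apply, Pi.neg_apply, Pi.div_apply, ← hc, e]
    field_simp
    ring
  exact ⟨(hGd 0).differentiableAt, key.differentiableAt, key.deriv⟩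

/-- directional second derivative (Hessian quadratic form) of the
population FA-DPO loss in the flip-model parameters at the true parameter:
for every direction `v`, `t ↦ F(ω* + t·v)` is twice differentiable at `0` with
second derivative `(1 − 2p)²·(1/p̃(ω*) + 1/(1 − p̃(ω*)))·σ′(⟨ω*, z⟩)²·⟨z, v⟩²`,
where `σ′(u) = σ(u)(1 − σ(u))`. -/
theorem fadpo_flipmodel_hessian (d : ℕ) (hd : 1 ≤ d)
    (z ωstar : EuclideanSpace ℝ (Fin d)) (p : ℝ) (hp : p ∈ Set.Ioo (0 : ℝ) 1)
    (ptilde : EuclideanSpace ℝ (Fin d) → ℝ)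
    (hptilde : ptilde = fun ω =>
      (1 - logisticSigmoid ⟪ω, z⟫) * p + logisticSigmoid ⟪ω, z⟫ * (1 - p))
    (F : EuclideanSpace ℝ (Fin d) → ℝ)
    (hF : F = fun ω =>
      -(ptilde ωstar * Real.log (ptilde ω) + (1 - ptilde ωstar) * Real.log (1 - ptilde ω))) :
    ∀ v : EuclideanSpace ℝ (Fin d),
      DifferentiableAt ℝ (fun t : ℝ => F (ωstar + t • v)) 0 ∧
      DifferentiableAt ℝ (deriv (fun t : ℝ => F (ωstar + t • v))) 0 ∧
      deriv (deriv (fun t : ℝ => F (ωstar + t • v))) 0 =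
        (1 - 2 * p) ^ 2 * (1 / ptilde ωstar + 1 / (1 - ptilde ωstar))
          * (logisticSigmoid ⟪ωstar, z⟫ * (1 - logisticSigmoid ⟪ωstar, z⟫)) ^ 2
          * ⟪z, v⟫ ^ 2 := by
  intro v
  have hin : ∀ t : ℝ, ⟪ωstar + t • v, z⟫ = ⟪ωstar, z⟫ + t * ⟪z, v⟫ := by
    intro t
    rw [inner_add_left, real_inner_smul_left, real_inner_comm z v]
  refine fadpo_aux ⟪ωstar, z⟫ ⟪z, v⟫ p (ptilde ωstar) hp (fun t => ptilde (ωstar + t • v))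
    ?_ ?_ _ ?_
  · funext t
    rw [hptilde]
    simp only [hin]
  · simp
  · rw [hF]
end

section
/- Let d ≥ 1, z ∈ ℝᵈ, ω* ∈ ℝᵈ, p ∈ (0,1), and constants δ > 0, c_σ > 0 with |1 − 2p| ≥ δ and σ′(⟨ω*, z⟩) ≥ c_σ, where σ′(u) = σ(u)(1 − σ(u)). Define ε(ω) = σ(⟨ω, z⟩), p̃(ω) = (1 − ε(ω))·p + ε(ω)·(1 − p), and F(ω) = −(p̃(ω*)·log p̃(ω) + (1 − p̃(ω*))·log(1 − p̃(ω))). Then for every v ∈ ℝᵈ, the second derivative of t ↦ F(ω* + t·v) at t = 0 is at least 4·δ²·c_σ²·⟨z, v⟩². -/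
open RealInnerProductSpace

theorem curv_aux (g g1 : ℝ → ℝ) (hg : ∀ t, HasDerivAt g (g1 t) t)
    (hg1 : DifferentiableAt ℝ g1 0) (h0 : ∀ t, 0 < g t) (h1 : ∀ t, g t < 1) :
    deriv (deriv (fun t => -(g 0 * Real.log (g t) + (1 - g 0) * Real.log (1 - g t)))) 0
      = g1 0 ^ 2 / (g 0 * (1 - g 0)) := by
  have e : deriv (fun t => -(g 0 * Real.log (g t) + (1 - g 0) * Real.log (1 - g t)))
      = fun t => (g1 t / (g t * (1 - g t))) * (g t - g 0) := by
    funext t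
    have a0 := h0 t
    have a1 : 0 < 1 - g t := by linarith [h1 t]
    have h := ((((hg t).log a0.ne').const_mul (g 0)).add
      ((((hg t).const_sub 1).log a1.ne').const_mul (1 - g 0))).neg
    refine (h.deriv).trans ?_
    field_simp
    ring
  rw [e]
  have a0 := h0 0
  have a1 : 0 < 1 - g 0 := by linarith [h1 0]
  have hh : DifferentiableAt ℝ (fun t => g1 t / (g t * (1 - g t))) 0 :=
    hg1.div ((hg 0).differentiableAt.mul ((hg 0).differentiableAt.const_sub 1))
      (mul_pos a0 a1).ne'
  have h := hh.hasDerivAt.mul ((hg 0).sub_const (g 0))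
  refine (h.deriv).trans ?_
  field_simp
  ring

theorem logisticSigmoid_eq_aux : logisticSigmoid = Real.sigmoid := by
  funext x
  simp [logisticSigmoid, Real.sigmoid_def]

/-- per-sample strong-convexity lower bound. Under `|1 − 2p| ≥ δ > 0`
and `σ′(⟨ω*, z⟩) ≥ c_σ > 0`, the second derivative of `t ↦ F(ω* + t·v)` at `0`
is at least `4·δ²·c_σ²·⟨z, v⟩²`. -/
theorem fadpo_flipmodel_curvature_lower_bound (d : ℕ) (hd : 1 ≤ d)
    (z ωstar : EuclideanSpace ℝ (Fin d)) (p : ℝ) (hp : p ∈ Set.Ioo (0 : ℝ) 1)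
    (δ cσ : ℝ) (hδ : 0 < δ) (hcσ : 0 < cσ)
    (hgap : δ ≤ |1 - 2 * p|)
    (hslope : cσ ≤ logisticSigmoid ⟪ωstar, z⟫ * (1 - logisticSigmoid ⟪ωstar, z⟫))
    (ptilde : EuclideanSpace ℝ (Fin d) → ℝ)
    (hptilde : ptilde = fun ω =>
      (1 - logisticSigmoid ⟪ω, z⟫) * p + logisticSigmoid ⟪ω, z⟫ * (1 - p))
    (F : EuclideanSpace ℝ (Fin d) → ℝ)
    (hF : F = fun ω =>
      -(ptilde ωstar * Real.log (ptilde ω) + (1 - ptilde ωstar) * Real.log (1 - ptilde ω))) :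
    ∀ v : EuclideanSpace ℝ (Fin d),
      4 * δ ^ 2 * cσ ^ 2 * ⟪z, v⟫ ^ 2 ≤
        deriv (deriv (fun t : ℝ => F (ωstar + t • v))) 0 := by
  intro v
  obtain ⟨hp0, hp1⟩ := hp
  rw [logisticSigmoid_eq_aux] at *
  set u : ℝ := ⟪ωstar, z⟫ with hu
  set w : ℝ := ⟪z, v⟫ with hw
  have hin : ∀ t : ℝ, ⟪ωstar + t • v, z⟫ = u + t * w := by
    intro t
    rw [inner_add_left, real_inner_smul_left, real_inner_comm]
    rw [hu, hw, real_inner_comm z ωstar, real_inner_comm v z]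
  have hs : ∀ t : ℝ, HasDerivAt (fun t : ℝ => Real.sigmoid (u + t * w))
      (Real.sigmoid (u + t * w) * (1 - Real.sigmoid (u + t * w)) * w) t := by
    intro t
    have h2 : HasDerivAt (fun t : ℝ => u + t * w) w t := by
      simpa using ((hasDerivAt_id t).mul_const w).const_add u
    have h3 := HasDerivAt.comp (h₂ := Real.sigmoid) t (Real.hasDerivAt_sigmoid (u + t * w)) h2
    exact h3
  have key := curv_aux
    (fun t => (1 - Real.sigmoid (u + t * w)) * p + Real.sigmoid (u + t * w) * (1 - p))
    (fun t => (1 - 2 * p) * (Real.sigmoid (u + t * w) * (1 - Real.sigmoid (u + t * w)) * w))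
    (by
      intro t
      have h := (((hs t).const_sub 1).mul_const p).add ((hs t).mul_const (1 - p))
      refine h.congr_deriv ?_
      ring)
    (by
      have h := (hs 0).differentiableAt
      exact ((h.mul (h.const_sub 1)).mul_const w).const_mul _)
    (by
      intro t
      have := Real.sigmoid_pos (u + t * w)
      have := Real.sigmoid_lt_one (u + t * w)
      have := mul_pos (sub_pos.2 this) hp0
      have := mul_pos (Real.sigmoid_pos (u + t * w)) (sub_pos.2 hp1)
      linarith)
    (by
      intro t
      have h1 := mul_pos (sub_pos.2 (Real.sigmoid_lt_one (u + t * w))) (sub_pos.2 hp1)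
      have h2 := mul_pos (Real.sigmoid_pos (u + t * w)) hp0
      nlinarith)
  have hFe : (fun t : ℝ => F (ωstar + t • v)) = fun t : ℝ =>
      -(((1 - Real.sigmoid (u + 0 * w)) * p + Real.sigmoid (u + 0 * w) * (1 - p)) *
        Real.log ((1 - Real.sigmoid (u + t * w)) * p + Real.sigmoid (u + t * w) * (1 - p)) +
        (1 - ((1 - Real.sigmoid (u + 0 * w)) * p + Real.sigmoid (u + 0 * w) * (1 - p))) *
        Real.log (1 - ((1 - Real.sigmoid (u + t * w)) * p +
          Real.sigmoid (u + t * w) * (1 - p)))) := by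
    funext t
    simp only [hF, hptilde, hin, zero_mul, add_zero, ← hu]
  rw [hFe, key]
  simp only [zero_mul, add_zero]
  have s0 := Real.sigmoid_pos u
  have s1 := Real.sigmoid_lt_one u
  generalize Real.sigmoid u = s at *
  have q0 : 0 < (1 - s) * p + s * (1 - p) := by
    have := mul_pos (sub_pos.2 s1) hp0
    have := mul_pos s0 (sub_pos.2 hp1)
    linarith
  have q1 : 0 < 1 - ((1 - s) * p + s * (1 - p)) := by
    have := mul_pos (sub_pos.2 s1) (sub_pos.2 hp1)
    have := mul_pos s0 hp0
    nlinarith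
  generalize (1 - s) * p + s * (1 - p) = q at *
  rw [le_div_iff₀ (mul_pos q0 q1)]
  have b1 : δ ^ 2 ≤ (1 - 2 * p) ^ 2 := by
    rw [← sq_abs (1 - 2 * p)]
    exact pow_le_pow_left₀ hδ.le hgap 2
  have b2 : cσ ^ 2 ≤ (s * (1 - s)) ^ 2 := pow_le_pow_left₀ hcσ.le hslope 2
  have b3 : 4 * (q * (1 - q)) ≤ 1 := by nlinarith [sq_nonneg (2 * q - 1)]
  calc 4 * δ ^ 2 * cσ ^ 2 * w ^ 2 * (q * (1 - q))
      = (δ ^ 2 * cσ ^ 2 * w ^ 2) * (4 * (q * (1 - q))) := by ring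
    _ ≤ (δ ^ 2 * cσ ^ 2 * w ^ 2) * 1 := by gcongr
    _ ≤ ((1 - 2 * p) ^ 2 * (s * (1 - s)) ^ 2 * w ^ 2) * 1 := by gcongr
    _ = _ := by ring
end
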